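/- Let Q ∈ {1, 2, 6, 42, 1806}. Then the set of positive integers not in 𝔑_Q equals the union over all divisors d of Q of the sets W_d(Q) := { K · p(p-1)/d : p prime, p ∤ Q, d | p-1, K a positive integer }. -/

import Mathlib

/-- The power sum `S m k = 1^m + 2^m + ⋯ + k^m`. -/
def S (m k : ℕ) : ℕ := ∑ i ∈ Finset.Icc 1 k, i ^ m

/-- The set `𝔑_Q` of positive integers `n` with `S_{Qn}(Qn) ≡ n (mod Qn)`. -/
def Nset (Q : ℕ) : Set ℕ := {n | 0 < n ∧ S (Q * n) (Q * n) ≡ n [MOD Q * n]}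

/-- The set `W_d(Q)` in the case `𝔫_Q = 1`. -/
def W (d Q : ℕ) : Set ℕ :=
  {m | ∃ p K : ℕ, Nat.Prime p ∧ ¬ p ∣ Q ∧ d ∣ p - 1 ∧ 0 < K ∧
    m = K * (p * (p - 1) / d)}

theorem prime_dvd_sum_pow_add_indicator {p : ℕ} (hp : p.Prime) {m : ℕ} (hm : m ≠ 0) :
    p ∣ ∑ i ∈ Finset.range p, (i + 1) ^ m + if p - 1 ∣ m then 1 else 0 := by
  have : Fact p.Prime := ⟨hp⟩
  have hbij : (∑ v ∈ Finset.Ico 1 p, (v : ZMod p) ^ m) = ∑ u : (ZMod p)ˣ, (u : ZMod p) ^ m :=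
    Finset.sum_bij'
      (fun v hv ↦ Units.mk0 (v : ZMod p) (mt (ZMod.natCast_eq_zero_iff v p).mp (by
        grind [Nat.not_dvd_of_pos_of_lt])))
      (fun u _ ↦ (u : ZMod p).val)
      (fun _ _ ↦ Finset.mem_univ _)
      (fun u _ ↦ by grind [u.ne_zero, ZMod.val_ne_zero, ZMod.val_lt])
      (fun v hv ↦ by simp [ZMod.val_cast_of_lt (Finset.mem_Ico.mp hv).2])
      (fun u _ ↦ Units.ext (ZMod.natCast_zmod_val _))
      (fun _ _ ↦ rfl)
  have hshift : ∑ i ∈ Finset.range p, ((i : ZMod p) + 1) ^ m =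
      ∑ v ∈ Finset.Ico 1 p, (v : ZMod p) ^ m := by
    obtain ⟨r, rfl⟩ : ∃ r, p = r + 1 := ⟨p - 1, by have := hp.pos; omega⟩
    have hr : (r : ZMod (r + 1)) + 1 = 0 := by exact_mod_cast ZMod.natCast_self (r + 1)
    rw [Finset.sum_range_succ, hr, zero_pow hm, add_zero, Finset.sum_Ico_eq_sum_range]
    refine Finset.sum_congr (by simp) fun i _ ↦ ?_
    push_cast
    exact congrArg (· ^ m) (add_comm _ _)
  rw [← ZMod.natCast_eq_zero_iff]
  push_cast
  rw [hshift, hbij, FiniteField.sum_pow_units, ZMod.card]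
  split_ifs <;> simp

theorem pow_modEq_pow_of_prime_pow_dvd {p k m a b : ℕ} (hm : p ^ k ∣ m) (h : a ≡ b [MOD p]) :
    a ^ m ≡ b ^ m [MOD p ^ (k + 1)] := by
  obtain ⟨r, rfl⟩ := hm
  rw [pow_mul, pow_mul]
  refine Nat.ModEq.pow r ?_
  have h' : (p : ℤ) ∣ (b : ℤ) - a := Nat.modEq_iff_dvd.mp h
  refine Nat.modEq_iff_dvd.mpr ?_
  exact_mod_cast dvd_sub_pow_of_dvd_sub h' k

theorem S_eq_sum_range (m k : ℕ) : S m k = ∑ i ∈ Finset.range k, (i + 1) ^ m := by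
  induction k with
  | zero => simp [S]
  | succ k ih => rw [S, Finset.sum_Icc_succ_top (by omega), Finset.sum_range_succ, ← ih, S]

theorem S_mul_modEq {p k m : ℕ} (hm : p ^ k ∣ m) (t : ℕ) :
    S m (p * t) ≡ t * ∑ i ∈ Finset.range p, (i + 1) ^ m [MOD p ^ (k + 1)] := by
  rw [S_eq_sum_range]
  induction t with
  | zero => simp [Nat.ModEq.refl]
  | succ t ih =>
    rw [Nat.mul_succ, Finset.sum_range_add, Nat.succ_mul]
    refine Nat.ModEq.add ih (Nat.ModEq.sum fun i _ ↦ pow_modEq_pow_of_prime_pow_dvd hm ?_)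
    simp [Nat.ModEq, Nat.add_assoc]

theorem prime_pow_dvd_S_add {p k M : ℕ} (hp : p.Prime) (hM : M ≠ 0) (h : p ^ (k + 1) ∣ M) :
    p ^ (k + 1) ∣ S M M + if p - 1 ∣ M then M / p else 0 := by
  obtain ⟨t, ht⟩ : p ∣ M := (dvd_pow_self p k.succ_ne_zero).trans h
  have hkt : p ^ k ∣ t := by
    rw [ht, pow_succ'] at h
    exact Nat.dvd_of_mul_dvd_mul_left hp.pos h
  have hdiv : M / p = t := by rw [ht, Nat.mul_div_cancel_left _ hp.pos]
  have hS : S M M ≡ t * ∑ i ∈ Finset.range p, (i + 1) ^ M [MOD p ^ (k + 1)] := by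
    conv_lhs => arg 2; rw [ht]
    exact S_mul_modEq ((pow_dvd_pow p k.le_succ).trans h) t
  rw [hdiv, Nat.ModEq.dvd_iff (hS.add_right _) dvd_rfl]
  have hsplit : (if p - 1 ∣ M then t else 0) = t * if p - 1 ∣ M then 1 else 0 := by simp
  rw [hsplit, ← mul_add, pow_succ]
  exact mul_dvd_mul hkt (prime_dvd_sum_pow_add_indicator hp hM)

theorem prime_pow_dvd_div {p q k M : ℕ} (hp : p.Prime) (hq : q.Prime) (hpq : p ≠ q)
    (hqM : q ∣ M) (h : p ^ k ∣ M) : p ^ k ∣ M / q := by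
  obtain ⟨t, rfl⟩ := hqM
  rw [Nat.mul_div_cancel_left _ hq.pos]
  exact (Nat.Coprime.pow_left k ((Nat.coprime_primes hp hq).mpr hpq)).dvd_of_dvd_mul_left h

theorem dvd_S_add_sum {M : ℕ} (hM : M ≠ 0) :
    M ∣ S M M + ∑ q ∈ M.primeFactors with q - 1 ∣ M, M / q := by
  rw [Nat.dvd_iff_prime_pow_dvd_dvd]
  rintro p (_ | k) hp h
  · simp
  have hpM : p ∈ M.primeFactors :=
    Nat.mem_primeFactors.mpr ⟨hp, (dvd_pow_self p k.succ_ne_zero).trans h, hM⟩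
  rw [Finset.sum_filter, ← Finset.add_sum_erase _ _ hpM, ← add_assoc]
  refine dvd_add (prime_pow_dvd_S_add hp hM h) (Finset.dvd_sum fun q hq ↦ ?_)
  obtain ⟨hne, hqM⟩ := Finset.mem_erase.mp hq
  split_ifs
  · exact prime_pow_dvd_div hp (Nat.prime_of_mem_primeFactors hqM) hne.symm
      (Nat.dvd_of_mem_primeFactors hqM) h
  · simp

theorem dvd_sum_div_primes_iff {M : ℕ} (hM : M ≠ 0) {R : Finset ℕ} (hR : R ⊆ M.primeFactors) :
    M ∣ ∑ q ∈ R, M / q ↔ R = ∅ := by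
  refine ⟨fun h ↦ ?_, fun h ↦ by simp [h]⟩
  by_contra hne
  obtain ⟨p, hpR⟩ := Finset.nonempty_iff_ne_empty.mpr hne
  have hp := Nat.prime_of_mem_primeFactors (hR hpR)
  have hpM := Nat.dvd_of_mem_primeFactors (hR hpR)
  have hpow := Nat.ordProj_dvd M p
  rw [← Finset.add_sum_erase _ _ hpR] at h
  have hrest : p ^ M.factorization p ∣ ∑ q ∈ R.erase p, M / q := by
    refine Finset.dvd_sum fun q hq ↦ ?_
    obtain ⟨hqp, hqR⟩ := Finset.mem_erase.mp hq
    exact prime_pow_dvd_div hp (Nat.prime_of_mem_primeFactors (hR hqR)) hqp.symm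
      (Nat.dvd_of_mem_primeFactors (hR hqR)) hpow
  have hdiv := (Nat.dvd_add_left hrest).mp (hpow.trans h)
  refine Nat.pow_succ_factorization_not_dvd hM hp ?_
  rw [pow_succ]
  calc p ^ M.factorization p * p ∣ M / p * p := mul_dvd_mul_right hdiv p
    _ = M := Nat.div_mul_cancel hpM

theorem mem_Nset_iff {Q n : ℕ} (hQ : Q ≠ 0) (hn : 0 < n)
    (hsum : ∑ q ∈ Q.primeFactors, Q / q + 1 = Q) (hpred : ∀ q ∈ Q.primeFactors, q - 1 ∣ Q) :
    n ∈ Nset Q ↔ ∀ p : ℕ, p.Prime → ¬ p ∣ Q → p ∣ n → ¬ p - 1 ∣ Q * n := by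
  have hM : Q * n ≠ 0 := mul_ne_zero hQ hn.ne'
  have hS := dvd_S_add_sum hM
  rw [← Finset.sum_filter_add_sum_filter_not _ (· ∣ Q)] at hS
  have hfilter : {q ∈ {q ∈ (Q * n).primeFactors | q - 1 ∣ Q * n} | q ∣ Q} = Q.primeFactors := by
    ext q
    simp only [Finset.mem_filter, Nat.mem_primeFactors]
    constructor
    · rintro ⟨⟨⟨hq, -, -⟩, -⟩, h⟩
      exact ⟨hq, h, hQ⟩
    · rintro ⟨hq, h, -⟩
      exact ⟨⟨⟨hq, h.mul_right n, hM⟩,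
        (hpred q (Nat.mem_primeFactors.mpr ⟨hq, h, hQ⟩)).mul_right n⟩, h⟩
  set R := {q ∈ {q ∈ (Q * n).primeFactors | q - 1 ∣ Q * n} | ¬ q ∣ Q} with hRdef
  have hR : R ⊆ (Q * n).primeFactors :=
    (Finset.filter_subset _ _).trans (Finset.filter_subset _ _)
  have hQsum : ∑ q ∈ Q.primeFactors, Q * n / q + n = Q * n := by
    have : ∀ q ∈ Q.primeFactors, Q * n / q = Q / q * n := fun q hq ↦
      Nat.div_mul_right_comm (Nat.dvd_of_mem_primeFactors hq) n |>.symm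
    rw [Finset.sum_congr rfl this, ← Finset.sum_mul]
    conv_rhs => rw [← hsum]
    ring
  rw [hfilter] at hS
  have hkey : S (Q * n) (Q * n) ≡ n [MOD Q * n] ↔ R = ∅ := by
    rw [← dvd_sum_div_primes_iff hM hR]
    constructor
    · intro h
      have h1 := (Nat.ModEq.dvd_iff (h.add_right _) dvd_rfl).mp hS
      rw [← add_assoc, add_comm n, hQsum] at h1
      exact (Nat.dvd_add_right dvd_rfl).mp h1
    · intro h
      rw [← add_assoc] at hS
      have h1 := (Nat.dvd_add_left h).mp hS
      refine Nat.ModEq.add_right_cancel' (∑ q ∈ Q.primeFactors, Q * n / q) ?_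
      rw [add_comm n, hQsum]
      exact ((Nat.modEq_zero_iff_dvd.mpr h1)).trans (Nat.modEq_zero_iff_dvd.mpr dvd_rfl).symm
  simp only [Nset, Set.mem_ofPred_eq, hn, true_and, hkey, Finset.eq_empty_iff_forall_notMem]
  refine forall_congr' fun p ↦ ?_
  simp only [hRdef, Finset.mem_filter, Nat.mem_primeFactors]
  constructor
  · intro h hp hpQ hpn hd
    exact h ⟨⟨⟨hp, hpn.mul_left Q, hM⟩, hd⟩, hpQ⟩
  · rintro h ⟨⟨⟨hp, hpM, -⟩, hd⟩, hpQ⟩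
    exact h hp hpQ ((hp.dvd_mul.mp hpM).resolve_left hpQ) hd

theorem exists_mem_W_iff {Q n : ℕ} (hQ : Q ≠ 0) (hn : 0 < n) :
    (∃ d ∈ Q.divisors, n ∈ W d Q) ↔
      ∃ p : ℕ, p.Prime ∧ ¬ p ∣ Q ∧ p ∣ n ∧ p - 1 ∣ Q * n := by
  constructor
  · rintro ⟨d, hd, p, K, hp, hpQ, hdp, -, rfl⟩
    have hdQ := Nat.dvd_of_mem_divisors hd
    rw [Nat.mul_div_assoc _ hdp]
    refine ⟨p, hp, hpQ, (dvd_mul_right p _).mul_left K, ?_⟩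
    calc p - 1 = d * ((p - 1) / d) := (Nat.mul_div_cancel' hdp).symm
      _ ∣ Q * (K * (p * ((p - 1) / d))) :=
        mul_dvd_mul hdQ ((dvd_mul_left _ p).mul_left K)
  · rintro ⟨p, hp, hpQ, hpn, hdvd⟩
    have hg : 0 < (p - 1).gcd Q := Nat.gcd_pos_of_pos_right _ (Nat.pos_of_ne_zero hQ)
    have hgp := Nat.gcd_dvd_left (p - 1) Q
    refine ⟨(p - 1).gcd Q, Nat.mem_divisors.mpr ⟨Nat.gcd_dvd_right _ _, hQ⟩, ?_⟩
    have h1 : (p - 1) / (p - 1).gcd Q ∣ n := by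
      refine (Nat.coprime_div_gcd_div_gcd hg).dvd_of_dvd_mul_left ?_
      rw [Nat.div_mul_right_comm (Nat.gcd_dvd_right _ _)]
      exact Nat.div_dvd_div hgp hdvd
    have hcop : p.Coprime ((p - 1) / (p - 1).gcd Q) := by
      refine Nat.Coprime.coprime_dvd_right (Nat.div_dvd_of_dvd hgp) ?_
      exact (Nat.coprime_self_sub_right hp.one_le).mpr p.coprime_one_right
    obtain ⟨K, hK⟩ := hcop.mul_dvd_of_dvd_of_dvd hpn h1
    refine ⟨p, K, hp, hpQ, hgp, Nat.pos_of_ne_zero ?_, ?_⟩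
    · rintro rfl
      simp [hK] at hn
    · rw [Nat.mul_div_assoc _ hgp, hK, mul_comm]

theorem pos_of_mem_W {d Q n : ℕ} (h : n ∈ W d Q) : 0 < n := by
  obtain ⟨p, K, hp, -, hdp, hK, rfl⟩ := h
  have h1 : 0 < p - 1 := Nat.sub_pos_of_lt hp.one_lt
  rw [Nat.mul_div_assoc _ hdp]
  exact Nat.mul_pos hK (Nat.mul_pos hp.pos
    (Nat.div_pos (Nat.le_of_dvd h1 hdp) (Nat.pos_of_dvd_of_pos hdp h1)))

theorem complement_Nset_eq {Q : ℕ} (hQ : Q ≠ 0)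
    (hsum : ∑ q ∈ Q.primeFactors, Q / q + 1 = Q) (hpred : ∀ q ∈ Q.primeFactors, q - 1 ∣ Q) :
    {n : ℕ | 0 < n} \ Nset Q = ⋃ d ∈ Nat.divisors Q, W d Q := by
  ext n
  simp only [Set.mem_sdiff, Set.mem_ofPred_eq, Set.mem_iUnion, exists_prop]
  constructor
  · rintro ⟨hn, h⟩
    rw [mem_Nset_iff hQ hn hsum hpred] at h
    rw [exists_mem_W_iff hQ hn]
    push Not at h
    exact h
  · intro h
    have hn : 0 < n := by
      obtain ⟨d, -, hd⟩ := h
      exact pos_of_mem_W hd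
    obtain ⟨p, hp, hpQ, hpn, hd⟩ := (exists_mem_W_iff hQ hn).mp h
    refine ⟨hn, fun hmem ↦ ?_⟩
    exact (mem_Nset_iff hQ hn hsum hpred).mp hmem p hp hpQ hpn hd

theorem complement_decomposition_small :
    ∀ Q ∈ ({1, 2, 6, 42, 1806} : Set ℕ),
      {n : ℕ | 0 < n} \ Nset Q = ⋃ d ∈ Nat.divisors Q, W d Q := by
  intro Q hQ
  simp only [Set.mem_insert_iff, Set.mem_singleton_iff] at hQ
  have h2 : Nat.primeFactors 2 = {2} := Nat.prime_two.primeFactors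
  have h6 : Nat.primeFactors 6 = {2, 3} := by
    rw [show 6 = 2 * 3 by norm_num, Nat.primeFactors_mul (by norm_num) (by norm_num), h2,
      Nat.prime_three.primeFactors]
    rfl
  have h42 : Nat.primeFactors 42 = {2, 3, 7} := by
    rw [show 42 = 6 * 7 by norm_num, Nat.primeFactors_mul (by norm_num) (by norm_num), h6,
      Nat.Prime.primeFactors (p := 7) (by norm_num)]
    rfl
  have h1806 : Nat.primeFactors 1806 = {2, 3, 7, 43} := by
    rw [show 1806 = 42 * 43 by norm_num, Nat.primeFactors_mul (by norm_num) (by norm_num), h42,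
      Nat.Prime.primeFactors (p := 43) (by norm_num)]
    rfl
  rcases hQ with rfl | rfl | rfl | rfl | rfl <;>
    refine complement_Nset_eq (by norm_num) ?_ ?_ <;>
    norm_num [h2, h6, h42, h1806]
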